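/- arXiv:2004.08703 — 5 statements merged into one kernel-verified Lean document; each statement's English description precedes it below -/
import Mathlib

section
/- Let ε ∈ (0,1/2], let G = (V,E) be a finite simple graph, and let x : E → ℝ≥0 satisfy: (i) Σ_{e ∋ v} x_e ≤ 1 for every vertex v, and (ii) for every edge e, either x_e = 1 or x_e ≤ ε⁵. Then all blossom inequalities over small odd sets hold: for every U ⊆ V with |U| odd and |U| ≤ 1/ε, Σ_{e = (a,b) : a,b ∈ U} x_e ≤ (|U| − 1)/2. -/
open scoped Classical

noncomputable section

/-- A unit-weight edge at `v` saturates the degree bound, so every other edge at `v` has weight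
zero. -/
theorem eq_zero_of_ne_of_saturated
    {V : Type} [DecidableEq V] (G : SimpleGraph V) [Fintype G.edgeSet]
    {x : Sym2 V → ℝ} (hx0 : ∀ e, 0 ≤ x e) {v : V}
    (hdeg : (∑ e ∈ G.edgeFinset.filter fun e => v ∈ e, x e) ≤ 1)
    {e f : Sym2 V} (he : e ∈ G.edgeFinset) (hve : v ∈ e) (hxe : x e = 1)
    (hf : f ∈ G.edgeFinset) (hvf : v ∈ f) (hfe : f ≠ e) : x f = 0 := by
  have h := Finset.add_le_sum (f := x) (fun i _ => hx0 i)
    (Finset.mem_filter.2 ⟨he, hve⟩ : e ∈ G.edgeFinset.filter fun e => v ∈ e)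
    (Finset.mem_filter.2 ⟨hf, hvf⟩) hfe.symm
  linarith [hx0 f]

/-- A set of `n` vertices spans at most `n.choose 2` edges. -/
theorem card_edges_inside_le_choose_two
    {V : Type} [Fintype V] [DecidableEq V] (G : SimpleGraph V) [Fintype G.edgeSet]
    (U : Finset V) :
    (G.edgeFinset.filter fun e => ∀ a ∈ e, a ∈ U).card ≤ U.card.choose 2 := by
  rw [← Sym2.card_image_offDiag]
  refine Finset.card_le_card fun e he => ?_
  rw [Finset.mem_filter, SimpleGraph.mem_edgeFinset] at he
  induction e with
  | _ a b =>
    exact Finset.mem_image.2 ⟨(a, b), Finset.mem_offDiag.2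
      ⟨he.2 a (Sym2.mem_mk_left a b), he.2 b (Sym2.mem_mk_right a b), he.1.ne⟩, rfl⟩

/-- Blossom inequalities over small odd sets: if `x : E → ℝ≥0` has `x_v ≤ 1` at every
vertex and every edge value is either `1` or at most `ε⁵`, then for every odd set `U`
with `|U| ≤ 1/ε` we have `x(U) ≤ (|U| − 1)/2`. -/
theorem blossom_inequalities_small_odd_sets
    {V : Type} [Fintype V] [DecidableEq V]
    (G : SimpleGraph V) [DecidableRel G.Adj]
    (ε : ℝ) (hε0 : 0 < ε) (hε1 : ε ≤ 1 / 2)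
    (x : Sym2 V → ℝ) (hx0 : ∀ e, 0 ≤ x e)
    (hdeg : ∀ v : V, (∑ e ∈ G.edgeFinset.filter fun e => v ∈ e, x e) ≤ 1)
    (hval : ∀ e ∈ G.edgeFinset, x e = 1 ∨ x e ≤ ε ^ 5) :
    ∀ U : Finset V, Odd U.card → (U.card : ℝ) ≤ 1 / ε →
      (∑ e ∈ G.edgeFinset.filter fun e => ∀ a ∈ e, a ∈ U, x e)
        ≤ ((U.card : ℝ) - 1) / 2 := by
  intro U
  induction U using Finset.strongInduction with
  | H U ih =>
    intro hodd hcard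
    by_cases hunit : ∃ e ∈ G.edgeFinset, (∀ a ∈ e, a ∈ U) ∧ x e = 1
    · obtain ⟨e, he, heU, hxe⟩ := hunit
      induction e with
      | _ a b =>
        have ha : a ∈ U := heU a (Sym2.mem_mk_left a b)
        have hb : b ∈ U := heU b (Sym2.mem_mk_right a b)
        have hab : a ≠ b := (SimpleGraph.mem_edgeFinset.1 he).ne
        have hb' : b ∈ U.erase a := Finset.mem_erase.2 ⟨hab.symm, hb⟩
        have hc : ((U.erase a).erase b).card + 2 = U.card := by
          rw [← Finset.card_erase_add_one ha, ← Finset.card_erase_add_one hb']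
        have hc' : (((U.erase a).erase b).card : ℝ) + 2 = U.card := by exact_mod_cast hc
        have hrest := ih ((U.erase a).erase b)
          ((Finset.erase_subset _ _).trans_ssubset (Finset.erase_ssubset ha))
          (by rw [Nat.odd_iff] at hodd ⊢; omega) (by linarith)
        have hsplit : ∑ e ∈ insert s(a, b)
              (G.edgeFinset.filter fun e => ∀ v ∈ e, v ∈ (U.erase a).erase b), x e
            = ∑ e ∈ G.edgeFinset.filter fun e => ∀ v ∈ e, v ∈ U, x e := by
          refine Finset.sum_subset (fun f hf => ?_) fun f hf hf' => ?_
          · rcases Finset.mem_insert.1 hf with rfl | hf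
            · exact Finset.mem_filter.2 ⟨he, heU⟩
            · rw [Finset.mem_filter] at hf ⊢
              exact ⟨hf.1, fun v hv => Finset.mem_of_mem_erase
                (Finset.mem_of_mem_erase (hf.2 v hv))⟩
          · rw [Finset.mem_filter] at hf
            rw [Finset.mem_insert, Finset.mem_filter, not_or] at hf'
            by_cases haf : a ∈ f
            · exact eq_zero_of_ne_of_saturated G hx0 (hdeg a) he
                (Sym2.mem_mk_left a b) hxe hf.1 haf hf'.1
            by_cases hbf : b ∈ f
            · exact eq_zero_of_ne_of_saturated G hx0 (hdeg b) he
                (Sym2.mem_mk_right a b) hxe hf.1 hbf hf'.1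
            refine absurd ⟨hf.1, fun v hv => ?_⟩ hf'.2
            exact Finset.mem_erase.2 ⟨fun h => hbf (h ▸ hv),
              Finset.mem_erase.2 ⟨fun h => haf (h ▸ hv), hf.2 v hv⟩⟩
        rw [← hsplit, Finset.sum_insert, hxe]
        · linarith
        · intro h
          simpa using (Finset.mem_filter.1 h).2 a (Sym2.mem_mk_left a b)
    · push Not at hunit
      have hn : (1 : ℝ) ≤ U.card := by exact_mod_cast hodd.pos
      have hcε : (U.card : ℝ) * ε ≤ 1 := (le_div_iff₀ hε0).1 hcard
      have hε : ε ^ 5 ≤ ε := pow_le_of_le_one hε0.le (by linarith) (by norm_num)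
      calc (∑ e ∈ G.edgeFinset.filter fun e => ∀ a ∈ e, a ∈ U, x e)
          ≤ (G.edgeFinset.filter fun e => ∀ a ∈ e, a ∈ U).card • ε ^ 5 := by
            refine Finset.sum_le_card_nsmul _ _ _ fun e he => ?_
            rw [Finset.mem_filter] at he
            exact (hval e he.1).resolve_left (hunit e he.1 he.2)
        _ ≤ (U.card.choose 2 : ℝ) * ε ^ 5 := by
            rw [nsmul_eq_mul]
            gcongr
            exact card_edges_inside_le_choose_two G U
        _ = (U.card * ε ^ 5) * ((U.card - 1) / 2) := by
            rw [Nat.cast_choose_two]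
            ring
        _ ≤ 1 * ((U.card - 1) / 2) := by
            refine mul_le_mul_of_nonneg_right ?_ (by linarith)
            exact (mul_le_mul_of_nonneg_left hε (by positivity)).trans hcε
        _ = (U.card - 1) / 2 := one_mul _
end
end

section
/- Every finite weighted hypergraph K = (V, E_K) with nonnegative edge weights w, maximum vertex degree at most Δ (each vertex lies in at most Δ hyperedges) and rank at most r (each hyperedge contains at most r vertices), where Δ, r ≥ 1, has a matching M_K ⊆ E_K (a set of pairwise vertex-disjoint hyperedges) with total weight Σ_{e ∈ M_K} w(e) ≥ (1/(rΔ)) · Σ_{e ∈ E_K} w(e). -/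
open scoped Classical

noncomputable section

/-- The weight of the hyperedges meeting `e` is at most `r * Δ` times a common upper bound. -/
lemma sum_filter_not_disjoint_le {V : Type} [DecidableEq V]
    (E : Finset (Finset V)) (w : Finset V → ℝ) (Δ r : ℕ)
    (hdeg : ∀ v : V, (E.filter fun e => v ∈ e).card ≤ Δ)
    (e : Finset V) (he : e.card ≤ r) (b : ℝ) (hb : 0 ≤ b) (hmax : ∀ f ∈ E, w f ≤ b) :
    ∑ f ∈ E.filter (fun f => ¬ Disjoint f e), w f ≤ r * Δ * b := by
  have hsub : E.filter (fun f => ¬ Disjoint f e) ⊆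
      e.biUnion fun v => E.filter fun f => v ∈ f := by
    intro f hf
    obtain ⟨hfE, hfe⟩ := Finset.mem_filter.1 hf
    obtain ⟨v, hvf, hve⟩ := Finset.not_disjoint_iff.1 hfe
    exact Finset.mem_biUnion.2 ⟨v, hve, Finset.mem_filter.2 ⟨hfE, hvf⟩⟩
  have hcard : (E.filter fun f => ¬ Disjoint f e).card ≤ r * Δ :=
    (Finset.card_le_card hsub).trans <|
      (Finset.card_biUnion_le_card_mul _ _ Δ fun v _ => hdeg v).trans <|
        Nat.mul_le_mul_right Δ he
  calc ∑ f ∈ E.filter (fun f => ¬ Disjoint f e), w f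
      ≤ (E.filter fun f => ¬ Disjoint f e).card • b :=
        Finset.sum_le_card_nsmul _ _ _ fun f hf => hmax f (Finset.mem_filter.1 hf).1
    _ = ((E.filter fun f => ¬ Disjoint f e).card : ℝ) * b := nsmul_eq_mul _ _
    _ ≤ r * Δ * b := by
        gcongr
        exact_mod_cast hcard

/-- Greedily picking a heaviest remaining hyperedge produces a matching whose weight, scaled by
`r * Δ`, is at least the total weight. -/
lemma exists_matching_sum_le_mul {V : Type} [DecidableEq V] (w : Finset V → ℝ) (Δ r : ℕ)
    (E : Finset (Finset V)) (hne : ∀ e ∈ E, e.Nonempty) (hw : ∀ e ∈ E, 0 ≤ w e)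
    (hdeg : ∀ v : V, (E.filter fun e => v ∈ e).card ≤ Δ) (hrank : ∀ e ∈ E, e.card ≤ r) :
    ∃ M ⊆ E, (∀ e ∈ M, ∀ f ∈ M, e ≠ f → Disjoint e f) ∧
      ∑ e ∈ E, w e ≤ r * Δ * ∑ e ∈ M, w e := by
  induction E using Finset.strongInduction with
  | H E ih =>
    obtain rfl | hE := E.eq_empty_or_nonempty
    · exact ⟨∅, by simp⟩
    obtain ⟨e, he, hmax⟩ := E.exists_max_image w hE
    have hee : ¬ Disjoint e e := fun h =>
      (hne e he).ne_empty ((Finset.disjoint_self_iff_empty e).1 h)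
    have hsub : E.filter (fun f => Disjoint f e) ⊆ E := Finset.filter_subset _ _
    obtain ⟨M, hM, hdisj, hsum⟩ := ih (E.filter fun f => Disjoint f e)
      (Finset.filter_ssubset.2 ⟨e, he, hee⟩)
      (fun f hf => hne f (hsub hf)) (fun f hf => hw f (hsub hf))
      (fun v => (Finset.card_le_card (Finset.filter_subset_filter _ hsub)).trans (hdeg v))
      (fun f hf => hrank f (hsub hf))
    have hMe : ∀ f ∈ M, Disjoint f e := fun f hf => (Finset.mem_filter.1 (hM hf)).2
    refine ⟨insert e M, Finset.insert_subset he (hM.trans hsub), ?_, ?_⟩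
    · intro f hf g hg hfg
      rcases Finset.mem_insert.1 hf with rfl | hfM <;> rcases Finset.mem_insert.1 hg with rfl | hgM
      · exact absurd rfl hfg
      · exact (hMe g hgM).symm
      · exact hMe f hfM
      · exact hdisj f hfM g hgM hfg
    · rw [Finset.sum_insert fun h => hee (hMe e h), mul_add,
        ← Finset.sum_filter_not_add_sum_filter E (fun f => Disjoint f e)]
      exact add_le_add
        (sum_filter_not_disjoint_le E w Δ r hdeg e (hrank e he) (w e) (hw e he) hmax) hsum

/-- Every finite weighted hypergraph with nonnegative edge weights, maximum degree
at most `Δ` and rank at most `r` has a matching of total weight at least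
`(1/(rΔ))` times the total weight of all hyperedges. -/
theorem hypergraph_greedy_matching
    {V : Type} [Fintype V] [DecidableEq V]
    (EK : Finset (Finset V)) (hne : ∀ e ∈ EK, e.Nonempty)
    (w : Finset V → ℝ) (hw : ∀ e ∈ EK, 0 ≤ w e)
    (Δ r : ℕ) (hΔ1 : 1 ≤ Δ) (hr1 : 1 ≤ r)
    (hdeg : ∀ v : V, (EK.filter fun e => v ∈ e).card ≤ Δ)
    (hrank : ∀ e ∈ EK, e.card ≤ r) :
    ∃ M ⊆ EK, (∀ e ∈ M, ∀ f ∈ M, e ≠ f → Disjoint e f) ∧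
      (1 / ((r : ℝ) * (Δ : ℝ))) * ∑ e ∈ EK, w e ≤ ∑ e ∈ M, w e := by
  obtain ⟨M, hM, hdisj, hsum⟩ := exists_matching_sum_le_mul w Δ r EK hne hw hdeg hrank
  refine ⟨M, hM, hdisj, ?_⟩
  have hpos : (0 : ℝ) < r * Δ := by positivity
  rwa [one_div, inv_mul_le_iff₀ hpos]
end
end

section
/- Let W = ((s₁,e₁),…,(s_k,e_k)) be an alternating multi-walk of a profile P = ((𝒢₁,M₁),…,(𝒢_α,M_α)). If e₁ ∈ M_{s₁} and e_k ∈ M_{s_k}, then W is applicable with respect to every subset V_s ⊆ V, i.e., d_{W,v} ≥ d̄_{W,v} holds for every vertex v ∈ V. -/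
open scoped Classical

noncomputable section

/-- A finset of edges is a matching if its edges are pairwise vertex-disjoint. -/
def IsMatchingF {V : Type} (M : Finset (Sym2 V)) : Prop :=
  ∀ e ∈ M, ∀ f ∈ M, e ≠ f → ∀ v : V, v ∈ e → v ∉ f

/-- The `i`-th edge of the walk with vertex sequence `u`. -/
def mwEdge {V : Type} {l : ℕ} (u : Fin (l + 1) → V) (i : Fin l) : Sym2 V :=
  s(u i.castSucc, u i.succ)

/-- `d_{W,v}` : the number of positions `i` of the multi-walk (given by walk indices
`s` and vertex sequence `u`) with `v ∈ e_i` and `e_i ∈ M_{s_i}`. -/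
def dW {V : Type} [DecidableEq V] {k l : ℕ} (M : Fin k → Finset (Sym2 V))
    (s : Fin l → Fin k) (u : Fin (l + 1) → V) (v : V) : ℕ :=
  (Finset.univ.filter fun i : Fin l =>
    v ∈ mwEdge u i ∧ mwEdge u i ∈ M (s i)).card

/-- `d̄_{W,v}` : the number of positions `i` with `v ∈ e_i` and `e_i ∉ M_{s_i}`. -/
def dWbar {V : Type} [DecidableEq V] {k l : ℕ} (M : Fin k → Finset (Sym2 V))
    (s : Fin l → Fin k) (u : Fin (l + 1) → V) (v : V) : ℕ :=
  (Finset.univ.filter fun i : Fin l =>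
    v ∈ mwEdge u i ∧ mwEdge u i ∉ M (s i)).card

/-- The `j`-th matching of the profile obtained by applying the multi-walk `(s, u)`:
`M'_j = (M_j ∪ {e_i : s_i = j, e_i ∉ M_j}) ∖ {e_i : s_i = j, e_i ∈ M_j}`. -/
def applyMW {V : Type} [DecidableEq V] {k l : ℕ} (M : Fin k → Finset (Sym2 V))
    (s : Fin l → Fin k) (u : Fin (l + 1) → V) (j : Fin k) : Finset (Sym2 V) :=
  (M j ∪ (Finset.univ.filter fun i : Fin l =>
      s i = j ∧ mwEdge u i ∉ M j).image (mwEdge u))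
    \ ((Finset.univ.filter fun i : Fin l =>
      s i = j ∧ mwEdge u i ∈ M j).image (mwEdge u))

/-- Lemma: if an alternating multi-walk `W` of a profile has `e₁ ∈ M_{s₁}` and
`e_k ∈ M_{s_k}`, then `W` is applicable with respect to every vertex subset, i.e.
`d_{W,v} ≥ d̄_{W,v}` for every vertex `v`. -/
theorem alternating_multiwalk_applicable
    {V : Type} [Fintype V] [DecidableEq V]
    (G : SimpleGraph V) [DecidableRel G.Adj]
    (k l : ℕ) (hl : 0 < l)
    (Gs M : Fin k → Finset (Sym2 V))
    (hGs : ∀ i, Gs i ⊆ G.edgeFinset)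
    (hMsub : ∀ i, M i ⊆ Gs i) (hMmatch : ∀ i, IsMatchingF (M i))
    (s : Fin l → Fin k) (u : Fin (l + 1) → V)
    (hedge : ∀ i, mwEdge u i ∈ Gs (s i))
    (hdistinct : ∀ i j : Fin l, i ≠ j → (s i, mwEdge u i) ≠ (s j, mwEdge u j))
    (halt : ∀ (i : ℕ) (hi : i + 1 < l),
      Xor' (mwEdge u ⟨i, Nat.lt_of_succ_lt hi⟩ ∈ M (s ⟨i, Nat.lt_of_succ_lt hi⟩))
           (mwEdge u ⟨i + 1, hi⟩ ∈ M (s ⟨i + 1, hi⟩)))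
    (happly : ∀ j : Fin k, IsMatchingF (applyMW M s u j))
    (hfirst : mwEdge u ⟨0, hl⟩ ∈ M (s ⟨0, hl⟩))
    (hlast : mwEdge u ⟨l - 1, Nat.sub_lt hl Nat.one_pos⟩
      ∈ M (s ⟨l - 1, Nat.sub_lt hl Nat.one_pos⟩)) :
    ∀ v : V, dWbar M s u v ≤ dW M s u v := by
  intro v
  have hloop : ∀ i : Fin l, u i.castSucc ≠ u i.succ := fun i h => by
    have hG := hGs _ (hedge i)
    rw [SimpleGraph.mem_edgeFinset, mwEdge, SimpleGraph.mem_edgeSet] at hG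
    exact hG.ne h
  have hpos : ∀ i : Fin l, mwEdge u i ∉ M (s i) → 0 < (i : ℕ) ∧ (i : ℕ) + 1 < l := by
    rintro ⟨i, hi⟩ hM
    refine ⟨Nat.pos_of_ne_zero ?_, ?_⟩
    · rintro rfl
      exact hM hfirst
    · by_contra hlt
      obtain rfl : i = l - 1 := by simp only at hlt; omega
      exact hM hlast
  unfold dW dWbar
  refine Finset.card_le_card_of_injOn
    (fun i => if u i.castSucc = v then ⟨i - 1, by omega⟩
      else if h : (i : ℕ) + 1 < l then ⟨i + 1, h⟩ else i) ?_ ?_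
  · intro i hi
    simp only [Finset.coe_filter, Finset.mem_univ, true_and, Set.mem_ofPred_eq] at hi ⊢
    obtain ⟨hv, hM⟩ := hi
    obtain ⟨h0, h1⟩ := hpos i hM
    obtain ⟨i, hil⟩ := i
    simp only at h0 h1
    split_ifs with hc
    · obtain ⟨j, rfl⟩ : ∃ j, i = j + 1 := ⟨i - 1, by omega⟩
      refine ⟨?_, ?_⟩
      · subst hc
        exact Sym2.mem_mk_right _ _
      · exact (Xor.or (halt j hil)).resolve_right hM
    · have hs : v = u (Fin.succ ⟨i, hil⟩) :=
        (Sym2.mem_iff.mp hv).resolve_left (Ne.symm hc)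
      refine ⟨?_, ?_⟩
      · subst hs
        exact Sym2.mem_mk_left _ _
      · exact (Xor.or (halt i h1)).resolve_left hM
  · have hcross : ∀ i j : Fin l, 0 < (i : ℕ) → (i : ℕ) - 1 = j + 1 → u i.castSucc = v →
        u j.succ = v → False := by
      rintro ⟨i, hi⟩ ⟨j, hj⟩ - hij hui huj
      obtain rfl : i = j + 2 := by simp only at hij; omega
      exact hloop ⟨j + 1, by omega⟩ (huj.trans hui.symm)
    intro i hi j hj hij
    simp only [Finset.coe_filter, Finset.mem_univ, true_and, Set.mem_ofPred_eq] at hi hj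
    obtain ⟨hvi, hMi⟩ := hi
    obtain ⟨hvj, hMj⟩ := hj
    obtain ⟨hi0, hi1⟩ := hpos i hMi
    obtain ⟨hj0, hj1⟩ := hpos j hMj
    simp only [dif_pos hi1, dif_pos hj1] at hij
    split_ifs at hij with hci hcj hcj <;> simp only [Fin.mk.injEq] at hij
    · exact Fin.ext (by omega)
    · exact (hcross i j hi0 hij hci ((Sym2.mem_iff.mp hvj).resolve_left (Ne.symm hcj)).symm).elim
    · exact (hcross j i hj0 hij.symm hcj
        ((Sym2.mem_iff.mp hvi).resolve_left (Ne.symm hci)).symm).elim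
    · exact Fin.ext (by omega)
end
end

section
/- Let P = ((𝒢₁,M₁),…,(𝒢_α,M_α)) be a profile and let 𝒲 be a finite set of alternating multi-walks of P that are pairwise vertex-disjoint (no vertex of G occurs in two distinct multi-walks of 𝒲). Let P' = ((𝒢₁,M'₁),…,(𝒢_α,M'_α)) be the result of applying all multi-walks of 𝒲 to P (in any order). Then P' is a profile (each M'_i is a matching of 𝒢_i) and Σ_{i=1}^α w(M'_i) − Σ_{i=1}^α w(M_i) = Σ_{W ∈ 𝒲} gain(W, P). -/
open scoped Classical

noncomputable section

/-- The `i`-th matching of the profile obtained by simultaneously applying the family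
of multi-walks `(s j, u j)`, `j : Fin m`:
`M'_i = (M_i ∪ ⋃_j {e : (i,e) ∈ W_j, e ∉ M_i}) ∖ ⋃_j {e : (i,e) ∈ W_j, e ∈ M_i}`. -/
def applyFam {V : Type} [DecidableEq V] {k m : ℕ} {l : Fin m → ℕ}
    (M : Fin k → Finset (Sym2 V)) (s : ∀ j, Fin (l j) → Fin k)
    (u : ∀ j, Fin (l j + 1) → V) (i : Fin k) : Finset (Sym2 V) :=
  (M i ∪ Finset.univ.biUnion fun j : Fin m =>
      (Finset.univ.filter fun t : Fin (l j) =>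
        s j t = i ∧ mwEdge (u j) t ∉ M i).image (mwEdge (u j)))
    \ (Finset.univ.biUnion fun j : Fin m =>
      (Finset.univ.filter fun t : Fin (l j) =>
        s j t = i ∧ mwEdge (u j) t ∈ M i).image (mwEdge (u j)))

/-- `gain(W, P) = ∑_{(i,e') ∈ W} (1(e' ∉ M_i) − 1(e' ∈ M_i)) · w(e')`. -/
def mwGain {V : Type} [DecidableEq V] {k l : ℕ} (w : Sym2 V → ℝ)
    (M : Fin k → Finset (Sym2 V)) (s : Fin l → Fin k) (u : Fin (l + 1) → V) : ℝ :=
  ∑ t : Fin l, (if mwEdge u t ∈ M (s t) then -(w (mwEdge u t)) else w (mwEdge u t))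

theorem mem_applyFam {V : Type} [DecidableEq V] {k m : ℕ} {l : Fin m → ℕ}
    {M : Fin k → Finset (Sym2 V)} {s : ∀ j, Fin (l j) → Fin k}
    {u : ∀ j, Fin (l j + 1) → V} {i : Fin k} {e : Sym2 V} :
    e ∈ applyFam M s u i ↔
      (e ∈ M i ∧ ∀ j t, s j t = i → mwEdge (u j) t ≠ e) ∨
      (e ∉ M i ∧ ∃ j t, s j t = i ∧ mwEdge (u j) t = e) := by
  simp only [applyFam, Finset.mem_sdiff, Finset.mem_union, Finset.mem_biUnion,
    Finset.mem_image, Finset.mem_filter, Finset.mem_univ, true_and]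
  grind

theorem mem_applyMW {V : Type} [DecidableEq V] {k l : ℕ}
    {M : Fin k → Finset (Sym2 V)} {s : Fin l → Fin k}
    {u : Fin (l + 1) → V} {i : Fin k} {e : Sym2 V} :
    e ∈ applyMW M s u i ↔
      (e ∈ M i ∧ ∀ t, s t = i → mwEdge u t ≠ e) ∨
      (e ∉ M i ∧ ∃ t, s t = i ∧ mwEdge u t = e) := by
  simp only [applyMW, Finset.mem_sdiff, Finset.mem_union,
    Finset.mem_image, Finset.mem_filter, Finset.mem_univ, true_and]
  grind

theorem exists_eq_of_mem_mwEdge {V : Type} {l : ℕ} {u : Fin (l + 1) → V} {t : Fin l} {v : V}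
    (h : v ∈ mwEdge u t) : ∃ a, u a = v := by
  rcases Sym2.mem_iff.1 h with h | h
  exacts [⟨_, h.symm⟩, ⟨_, h.symm⟩]

/-- An edge of `applyFam` meeting the `j`-th walk lies in the matching obtained by applying that
walk alone. -/
theorem mem_applyMW_of_mem_applyFam {V : Type} [DecidableEq V] {k m : ℕ} {l : Fin m → ℕ}
    {M : Fin k → Finset (Sym2 V)} {s : ∀ j, Fin (l j) → Fin k}
    {u : ∀ j, Fin (l j + 1) → V}
    (hdisj : ∀ j j' : Fin m, j ≠ j' → ∀ a b, u j a ≠ u j' b)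
    {i : Fin k} {e : Sym2 V} {j : Fin m} {a : Fin (l j + 1)}
    (he : e ∈ applyFam M s u i) (ha : u j a ∈ e) : e ∈ applyMW M (s j) (u j) i := by
  rw [mem_applyMW]
  rcases mem_applyFam.1 he with ⟨h, h'⟩ | ⟨h, j', t, hs, rfl⟩
  · exact Or.inl ⟨h, h' j⟩
  · obtain ⟨b, hb⟩ := exists_eq_of_mem_mwEdge ha
    obtain rfl : j = j' := by
      by_contra hne
      exact hdisj j j' hne a b hb.symm
    exact Or.inr ⟨h, t, hs, rfl⟩

theorem isMatchingF_applyFam {V : Type} [DecidableEq V] {k m : ℕ} {l : Fin m → ℕ}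
    {M : Fin k → Finset (Sym2 V)} {s : ∀ j, Fin (l j) → Fin k}
    {u : ∀ j, Fin (l j + 1) → V} {i : Fin k} (hM : IsMatchingF (M i))
    (happly : ∀ j, IsMatchingF (applyMW M (s j) (u j) i))
    (hdisj : ∀ j j' : Fin m, j ≠ j' → ∀ a b, u j a ≠ u j' b) :
    IsMatchingF (applyFam M s u i) := by
  intro e he f hf hef v hve hvf
  by_cases hv : ∃ j a, u j a = v
  · obtain ⟨j, a, rfl⟩ := hv
    exact happly j e (mem_applyMW_of_mem_applyFam hdisj he hve) f
      (mem_applyMW_of_mem_applyFam hdisj hf hvf) hef _ hve hvf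
  · have key : ∀ g ∈ applyFam M s u i, v ∈ g → g ∈ M i := by
      intro g hg hvg
      rcases mem_applyFam.1 hg with ⟨h, -⟩ | ⟨-, j, t, -, rfl⟩
      · exact h
      · exact absurd ⟨j, exists_eq_of_mem_mwEdge hvg⟩ hv
    exact hM e (key e he hve) f (key f hf hvf) hef v hve hvf

/-- Summing over the edges occurring in a family of vertex-disjoint multi-walks with a given
index and satisfying `p` amounts to summing over the corresponding positions. -/
theorem sum_biUnion_mwEdge {V : Type} [DecidableEq V] {k m : ℕ} {l : Fin m → ℕ}
    {s : ∀ j, Fin (l j) → Fin k} {u : ∀ j, Fin (l j + 1) → V}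
    (hdistinct : ∀ j, ∀ t t' : Fin (l j), t ≠ t' →
      (s j t, mwEdge (u j) t) ≠ (s j t', mwEdge (u j) t'))
    (hdisj : ∀ j j' : Fin m, j ≠ j' → ∀ a b, u j a ≠ u j' b)
    (w : Sym2 V → ℝ) (i : Fin k) (p : Sym2 V → Prop) [DecidablePred p] :
    (∑ e ∈ Finset.univ.biUnion fun j : Fin m =>
      (Finset.univ.filter fun t : Fin (l j) =>
        s j t = i ∧ p (mwEdge (u j) t)).image (mwEdge (u j)), w e) =
    ∑ j, ∑ t, if s j t = i ∧ p (mwEdge (u j) t) then w (mwEdge (u j) t) else 0 := by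
  rw [Finset.sum_biUnion]
  · refine Finset.sum_congr rfl fun j _ => ?_
    rw [Finset.sum_image, Finset.sum_filter]
    intro t ht t' ht' h
    simp only [Finset.coe_filter, Finset.mem_univ, true_and, Set.mem_ofPred_eq] at ht ht'
    by_contra hne
    exact hdistinct j t t' hne (Prod.ext (ht.1.trans ht'.1.symm) h)
  · intro j _ j' _ hne
    refine Finset.disjoint_left.2 fun e he he' => ?_
    obtain ⟨t, -, rfl⟩ := Finset.mem_image.1 he
    obtain ⟨t', -, h⟩ := Finset.mem_image.1 he'
    have hmem : u j t.castSucc ∈ mwEdge (u j') t' := h ▸ Sym2.mem_mk_left _ _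
    obtain ⟨b, hb⟩ := exists_eq_of_mem_mwEdge hmem
    exact hdisj j j' hne _ b hb.symm

theorem sum_applyFam_sub {V : Type} [DecidableEq V] {k m : ℕ} {l : Fin m → ℕ}
    (M : Fin k → Finset (Sym2 V)) {s : ∀ j, Fin (l j) → Fin k} {u : ∀ j, Fin (l j + 1) → V}
    (hdistinct : ∀ j, ∀ t t' : Fin (l j), t ≠ t' →
      (s j t, mwEdge (u j) t) ≠ (s j t', mwEdge (u j) t'))
    (hdisj : ∀ j j' : Fin m, j ≠ j' → ∀ a b, u j a ≠ u j' b)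
    (w : Sym2 V → ℝ) (i : Fin k) :
    ∑ e ∈ applyFam M s u i, w e - ∑ e ∈ M i, w e =
      ∑ j, ∑ t, if s j t = i then
        (if mwEdge (u j) t ∈ M (s j t) then -w (mwEdge (u j) t) else w (mwEdge (u j) t))
        else 0 := by
  have hadd := sum_biUnion_mwEdge hdistinct hdisj w i (fun e => e ∉ M i)
  have hrem := sum_biUnion_mwEdge hdistinct hdisj w i (fun e => e ∈ M i)
  have hsub := Finset.sum_sdiff (f := w) (s₁ := Finset.univ.biUnion fun j : Fin m =>
      (Finset.univ.filter fun t : Fin (l j) =>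
        s j t = i ∧ mwEdge (u j) t ∈ M i).image (mwEdge (u j)))
    (s₂ := M i ∪ Finset.univ.biUnion fun j : Fin m =>
      (Finset.univ.filter fun t : Fin (l j) =>
        s j t = i ∧ mwEdge (u j) t ∉ M i).image (mwEdge (u j))) (by
      intro e he
      simp only [Finset.mem_union, Finset.mem_biUnion, Finset.mem_image, Finset.mem_filter,
        Finset.mem_univ, true_and] at he ⊢
      grind)
  rw [Finset.sum_union (by
      refine Finset.disjoint_left.2 fun e he he' => ?_
      simp only [Finset.mem_biUnion, Finset.mem_image, Finset.mem_filter,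
        Finset.mem_univ, true_and] at he'
      grind), hadd, hrem] at hsub
  have happ : ∑ e ∈ applyFam M s u i, w e = ∑ e ∈ M i, w e +
      (∑ j, ∑ t, if s j t = i ∧ mwEdge (u j) t ∉ M i then w (mwEdge (u j) t) else 0) -
      ∑ j, ∑ t, if s j t = i ∧ mwEdge (u j) t ∈ M i then w (mwEdge (u j) t) else 0 := by
    rw [← hsub, add_sub_cancel_right]
    unfold applyFam
    congr!
  rw [happ, add_sub_assoc, add_sub_cancel_left]
  simp only [← Finset.sum_sub_distrib]
  refine Finset.sum_congr rfl fun j _ => Finset.sum_congr rfl fun t _ => ?_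
  by_cases h : s j t = i
  · subst h
    by_cases h' : mwEdge (u j) t ∈ M (s j t) <;> simp [h']
  · simp [h]

/-- Lemma: applying a set of pairwise vertex-disjoint alternating multi-walks of a
profile yields again a profile, and the total weight of the matchings increases by
exactly the sum of the gains of the multi-walks. -/
theorem apply_disjoint_multiwalks
    {V : Type} [Fintype V] [DecidableEq V]
    (G : SimpleGraph V) [DecidableRel G.Adj] (w : Sym2 V → ℝ)
    (k : ℕ) (Gs M : Fin k → Finset (Sym2 V))
    (hGs : ∀ i, Gs i ⊆ G.edgeFinset)
    (hMsub : ∀ i, M i ⊆ Gs i) (hMmatch : ∀ i, IsMatchingF (M i))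
    (m : ℕ) (l : Fin m → ℕ)
    (s : ∀ j, Fin (l j) → Fin k) (u : ∀ j, Fin (l j + 1) → V)
    -- each (s j, u j) is a multi-walk of the profile
    (hedge : ∀ j t, mwEdge (u j) t ∈ Gs (s j t))
    (hdistinct : ∀ j, ∀ t t' : Fin (l j), t ≠ t' →
      (s j t, mwEdge (u j) t) ≠ (s j t', mwEdge (u j) t'))
    -- each multi-walk is alternating …
    (halt : ∀ j, ∀ (t : ℕ) (ht : t + 1 < l j),
      Xor' (mwEdge (u j) ⟨t, Nat.lt_of_succ_lt ht⟩ ∈ M (s j ⟨t, Nat.lt_of_succ_lt ht⟩))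
           (mwEdge (u j) ⟨t + 1, ht⟩ ∈ M (s j ⟨t + 1, ht⟩)))
    -- … and applying it alone yields a profile
    (happly : ∀ j, ∀ i : Fin k, IsMatchingF (applyMW M (s j) (u j) i))
    -- the multi-walks are pairwise vertex-disjoint
    (hdisj : ∀ j j' : Fin m, j ≠ j' → ∀ a b, u j a ≠ u j' b) :
    (∀ i, applyFam M s u i ⊆ Gs i ∧ IsMatchingF (applyFam M s u i)) ∧
    (∑ i, ∑ e ∈ applyFam M s u i, w e) - (∑ i, ∑ e ∈ M i, w e)
      = ∑ j, mwGain w M (s j) (u j) := by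
  refine ⟨fun i => ⟨fun e he => ?_, isMatchingF_applyFam (hMmatch i) (fun j => happly j i) hdisj⟩,
    ?_⟩
  · rcases mem_applyFam.1 he with ⟨h, -⟩ | ⟨-, j, t, rfl, rfl⟩
    · exact hMsub i h
    · exact hedge j t
  · rw [← Finset.sum_sub_distrib,
      Finset.sum_congr rfl fun i _ => sum_applyFam_sub M hdistinct hdisj w i, Finset.sum_comm]
    refine Finset.sum_congr rfl fun j _ => ?_
    rw [Finset.sum_comm]
    simp only [mwGain, Finset.sum_ite_eq, Finset.mem_univ, if_true]
end
end

section
/- Let ε ∈ (0, 2/5) and let m ∈ ℕ with m ≥ ε⁻¹². Let (X₁,Y₁),…,(X_m,Y_m) be independent random pairs (the pairs independent of each other, while X_j and Y_j within a pair may be dependent) with X_j, Y_j ∈ {0,1}, and suppose Σ_{j=1}^m E[Y_j] − Σ_{j=1}^m E[X_j] ≥ m·(ε³ − 1/(m+1)). Then Pr[Σ_{j=1}^m X_j ≥ Σ_{j=1}^m Y_j] ≤ 2ε⁴. -/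
open scoped Classical

noncomputable section

section ProductExpectation

variable {ι : Type*} [Fintype ι] [DecidableEq ι] {Ω : ι → Type*} [∀ j, Fintype (Ω j)]

theorem sum_pi_prod_mul_prod (μ g : ∀ j, Ω j → ℝ) :
    ∑ ω : (∀ j, Ω j), (∏ j, μ j (ω j)) * ∏ j, g j (ω j) = ∏ j, ∑ x, μ j x * g j x := by
  rw [Finset.prod_univ_sum, Fintype.piFinset_univ]
  simp only [Finset.prod_mul_distrib]

theorem sum_pi_prod_mul_apply {μ : ∀ j, Ω j → ℝ} (hμ : ∀ j, ∑ x, μ j x = 1)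
    (g : ∀ j, Ω j → ℝ) (i : ι) :
    ∑ ω : (∀ j, Ω j), (∏ j, μ j (ω j)) * g i (ω i) = ∑ x, μ i x * g i x := by
  have h := sum_pi_prod_mul_prod μ (fun j x => if j = i then g j x else 1)
  simp only [Finset.prod_ite_eq', Finset.mem_univ, if_true] at h
  rw [h, Finset.prod_eq_single i]
  · simp
  · intro j _ hj
    simp [hj, hμ]
  · simp

theorem sum_pi_prod_mul_apply_mul_apply {μ g : ∀ j, Ω j → ℝ}
    {i k : ι} (hik : i ≠ k) (hg : ∑ x, μ i x * g i x = 0) :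
    ∑ ω : (∀ j, Ω j), (∏ j, μ j (ω j)) * (g i (ω i) * g k (ω k)) = 0 := by
  have h := sum_pi_prod_mul_prod μ
    (fun j x => (if j = i then g j x else 1) * (if j = k then g j x else 1))
  simp only [Finset.prod_mul_distrib, Finset.prod_ite_eq', Finset.mem_univ, if_true] at h
  rw [h]
  apply Finset.prod_eq_zero (Finset.mem_univ i)
  simpa [hik] using hg

/-- The variance of a sum of independent centred random variables is the sum of the variances. -/
theorem sum_pi_prod_mul_sum_sq {μ g : ∀ j, Ω j → ℝ} (hμ : ∀ j, ∑ x, μ j x = 1)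
    (hg : ∀ j, ∑ x, μ j x * g j x = 0) :
    ∑ ω : (∀ j, Ω j), (∏ j, μ j (ω j)) * (∑ j, g j (ω j)) ^ 2 =
      ∑ j, ∑ x, μ j x * g j x ^ 2 := by
  simp only [sq (∑ j, _), Finset.sum_mul_sum]
  simp only [Finset.mul_sum]
  rw [Finset.sum_comm]
  refine Finset.sum_congr rfl fun i _ => ?_
  rw [Finset.sum_comm, Finset.sum_eq_single i]
  · simpa only [← sq] using sum_pi_prod_mul_apply hμ (fun j x => g j x ^ 2) i
  · intro k _ hk
    exact sum_pi_prod_mul_apply_mul_apply hk.symm (hg i)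
  · simp

/-- Chebyshev's inequality for a sum of independent random variables bounded by one. -/
theorem sq_mul_sum_pi_prod_mul_indicator_le {μ D : ∀ j, Ω j → ℝ} (hμ0 : ∀ j x, 0 ≤ μ j x)
    (hμ : ∀ j, ∑ x, μ j x = 1) (hD : ∀ j x, D j x ^ 2 ≤ 1)
    (hs : 0 ≤ ∑ j, ∑ x, μ j x * D j x) :
    (∑ j, ∑ x, μ j x * D j x) ^ 2 *
      ∑ ω : (∀ j, Ω j), (∏ j, μ j (ω j)) * (if ∑ j, D j (ω j) ≤ 0 then 1 else 0) ≤
      Fintype.card ι := by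
  set e : ι → ℝ := fun j => ∑ x, μ j x * D j x with he
  have hvar := sum_pi_prod_mul_sum_sq (g := fun j x => D j x - e j) hμ (fun j => by
    simp only [mul_sub, Finset.sum_sub_distrib, ← Finset.sum_mul, hμ, one_mul, he, sub_self])
  have hle : ∑ j, ∑ x, μ j x * (D j x - e j) ^ 2 ≤ Fintype.card ι := by
    have : ∀ j ∈ Finset.univ, ∑ x, μ j x * (D j x - e j) ^ 2 ≤ (1 : ℝ) := fun j _ => by
      have hexp : ∑ x, μ j x * (D j x - e j) ^ 2 = ∑ x, μ j x * D j x ^ 2 - e j ^ 2 := by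
        calc _ = ∑ x, (μ j x * D j x ^ 2 - 2 * e j * (μ j x * D j x) + e j ^ 2 * μ j x) :=
              Finset.sum_congr rfl fun x _ => by ring
          _ = _ := by
            rw [Finset.sum_add_distrib, Finset.sum_sub_distrib, ← Finset.mul_sum,
              ← Finset.mul_sum, hμ]
            change _ - 2 * e j * e j + _ = _
            ring
      have hsec : ∑ x, μ j x * D j x ^ 2 ≤ ∑ x, μ j x :=
        Finset.sum_le_sum fun x _ => mul_le_of_le_one_right (hμ0 j x) (hD j x)
      rw [hμ] at hsec
      nlinarith [sq_nonneg (e j)]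
    simpa using Finset.sum_le_sum this
  rw [Finset.mul_sum]
  refine le_trans (Finset.sum_le_sum fun ω _ => ?_) (hvar.trans_le hle)
  rw [mul_left_comm]
  refine mul_le_mul_of_nonneg_left ?_ (Finset.prod_nonneg fun j _ => hμ0 j _)
  rw [Finset.sum_sub_distrib]
  split_ifs with h
  · nlinarith
  · simpa using sq_nonneg _

end ProductExpectation

theorem one_le_mul_sq_gap {ε m : ℝ} (hε0 : 0 < ε) (hε1 : ε < 2 / 5) (hm : ε⁻¹ ^ 12 ≤ m) :
    0 < ε ^ 3 - 1 / (m + 1) ∧ 1 ≤ 2 * ε ^ 4 * (m * (ε ^ 3 - 1 / (m + 1)) ^ 2) := by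
  have hm' : 1 ≤ m * ε ^ 12 := by
    rw [inv_pow] at hm
    exact (inv_le_iff_one_le_mul₀ (by positivity)).1 hm
  have hm0 : 0 < m := lt_of_lt_of_le (by positivity) hm
  have hinv : 1 / (m + 1) ≤ ε ^ 12 := by
    rw [div_le_iff₀ (by positivity)]
    nlinarith [pow_pos hε0 12]
  have hε9 : ε ^ 9 ≤ 1 / 100 :=
    (pow_le_pow_left₀ hε0.le hε1.le 9).trans (by norm_num)
  have hε2 : ε ^ 2 ≤ 4 / 25 :=
    (pow_le_pow_left₀ hε0.le hε1.le 2).trans (by norm_num)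
  have hδ : 99 / 100 * ε ^ 3 ≤ ε ^ 3 - 1 / (m + 1) := by
    nlinarith [pow_pos hε0 3]
  refine ⟨lt_of_lt_of_le (by positivity) hδ, ?_⟩
  calc (1 : ℝ) ≤ m * ε ^ 12 := hm'
    _ = ε ^ 2 * (m * ε ^ 10) := by ring
    _ ≤ 4 / 25 * (m * ε ^ 10) := by gcongr
    _ ≤ 2 * (99 / 100) ^ 2 * (m * ε ^ 10) := by gcongr; norm_num
    _ = 2 * ε ^ 4 * (m * (99 / 100 * ε ^ 3) ^ 2) := by ring
    _ ≤ _ := by gcongr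

/-- Chebyshev-type bound for independent pairs of `{0,1}`-valued random variables:
if the pairs `(X_j, Y_j)` are independent across `j` (modelled by a product
probability space `∀ j, Ω j`), `m ≥ ε⁻¹²`, and
`∑ E[Y_j] − ∑ E[X_j] ≥ m·(ε³ − 1/(m+1))`, then `Pr[∑ X_j ≥ ∑ Y_j] ≤ 2ε⁴`. -/
theorem independent_pairs_gap_bound
    (ε : ℝ) (hε0 : 0 < ε) (hε1 : ε < 2 / 5)
    (m : ℕ) (hm : ε⁻¹ ^ 12 ≤ (m : ℝ))
    (Ω : Fin m → Type) [∀ j, Fintype (Ω j)]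
    (μ : ∀ j, Ω j → ℝ) (hμ0 : ∀ j ω, 0 ≤ μ j ω) (hμ1 : ∀ j, ∑ ω, μ j ω = 1)
    (X Y : ∀ j, Ω j → ℝ)
    (hX : ∀ j ω, X j ω = 0 ∨ X j ω = 1) (hY : ∀ j ω, Y j ω = 0 ∨ Y j ω = 1)
    (hgap : (m : ℝ) * (ε ^ 3 - 1 / ((m : ℝ) + 1))
      ≤ (∑ j, ∑ ω, μ j ω * Y j ω) - ∑ j, ∑ ω, μ j ω * X j ω) :
    (∑ ω : (∀ j, Ω j), (∏ j, μ j (ω j)) *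
        (if (∑ j, Y j (ω j)) ≤ ∑ j, X j (ω j) then 1 else 0)) ≤ 2 * ε ^ 4 := by
  obtain ⟨hδ, hnum⟩ := one_le_mul_sq_gap hε0 hε1 hm
  have hm0 : (0 : ℝ) < m := lt_of_lt_of_le (by positivity) hm
  have hmean : ∑ j, ∑ ω, μ j ω * (Y j ω - X j ω) =
      (∑ j, ∑ ω, μ j ω * Y j ω) - ∑ j, ∑ ω, μ j ω * X j ω := by
    simp only [mul_sub, Finset.sum_sub_distrib]
  rw [← hmean] at hgap
  have hs := (mul_pos hm0 hδ).trans_le hgap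
  have hcheb := sq_mul_sum_pi_prod_mul_indicator_le (D := fun j ω => Y j ω - X j ω) hμ0 hμ1
    (fun j ω => by rcases hX j ω with h | h <;> rcases hY j ω with h' | h' <;> norm_num [h, h'])
    hs.le
  simp only [Finset.sum_sub_distrib (f := fun j => Y j _), sub_nonpos, Fintype.card_fin] at hcheb
  refine le_of_mul_le_mul_left (hcheb.trans ?_) (pow_pos hs 2)
  have hsq := pow_le_pow_left₀ (mul_pos hm0 hδ).le hgap 2
  calc (m : ℝ) ≤ m * (2 * ε ^ 4 * (m * (ε ^ 3 - 1 / ((m : ℝ) + 1)) ^ 2)) :=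
        le_mul_of_one_le_right hm0.le hnum
    _ = (m * (ε ^ 3 - 1 / ((m : ℝ) + 1))) ^ 2 * (2 * ε ^ 4) := by ring
    _ ≤ _ := by gcongr
end
end
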